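/- Let S be a conical refinement commutative monoid whose algebraic preorder is antisymmetric, in which every nonempty subset has an infimum, which has general comparability, is Boolean-valued, and in which every element is the sum of a directly finite element and a purely infinite element. Then for every subset X of S, every element z ∈ S can be written as z = u + v with u ∈ X^⊥ and v ∈ X^⊥⊥, and this decomposition is unique. -/

import Mathlib

namespace PaperCDS

variable {M : Type*} [AddCommMonoid M]

/-- The algebraic preorder: `a ≤ b` iff `a + c = b` for some `c`. -/
def algLe (a b : M) : Prop := ∃ c : M, a + c = b

/-- `S` is conical if `a + b = 0` implies `a = 0` and `b = 0`. -/
def Conical (M : Type*) [AddCommMonoid M] : Prop :=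
  ∀ a b : M, a + b = 0 → a = 0 ∧ b = 0

/-- The refinement property. -/
def Refinement (M : Type*) [AddCommMonoid M] : Prop :=
  ∀ a₀ a₁ b₀ b₁ : M, a₀ + a₁ = b₀ + b₁ →
    ∃ c₀₀ c₀₁ c₁₀ c₁₁ : M,
      a₀ = c₀₀ + c₀₁ ∧ a₁ = c₁₀ + c₁₁ ∧ b₀ = c₀₀ + c₁₀ ∧ b₁ = c₀₁ + c₁₁

/-- Orthogonality: `a ⊥ b` iff the only `x` with `x ≤ a` and `x ≤ b` is `0`. -/
def Orth (a b : M) : Prop := ∀ x : M, algLe x a → algLe x b → x = 0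

/-- `X^⊥ = {s : s ⊥ x for all x ∈ X}`. -/
def perpSet (X : Set M) : Set M := {s : M | ∀ x ∈ X, Orth s x}

/-- An ideal: a nonempty subset `I` with `a + b ∈ I ↔ a ∈ I ∧ b ∈ I`. -/
def IsIdeal (I : Set M) : Prop :=
  I.Nonempty ∧ ∀ a b : M, a + b ∈ I ↔ a ∈ I ∧ b ∈ I

/-- An additive endomorphism. -/
def IsAddEndo (p : M → M) : Prop :=
  p 0 = 0 ∧ ∀ x y : M, p (x + y) = p x + p y

/-- A projection: an additive endomorphism `p` such that every `x` can be written
`x = p x + y` with `y` orthogonal to every element of the range of `p`. -/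
def IsProjection (p : M → M) : Prop :=
  IsAddEndo p ∧ ∀ x : M, ∃ y : M, x = p x + y ∧ ∀ s : M, Orth y (p s)

/-- A complementary pair of projections. -/
def ComplPair (p q : M → M) : Prop :=
  IsAddEndo p ∧ IsAddEndo q ∧
    ∀ x : M, p x + q x = x ∧ p (q x) = 0 ∧ q (p x) = 0

/-- General comparability. -/
def GenComp (M : Type*) [AddCommMonoid M] : Prop :=
  ∀ a b : M, ∃ p q : M → M, ComplPair p q ∧ algLe (p a) (p b) ∧ algLe (q b) (q a)

/-- `S` is Boolean-valued. -/
def BoolValued (M : Type*) [AddCommMonoid M] : Prop :=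
  ∀ a b : M, ∃ p q : M → M, ComplPair p q ∧ algLe (p a) (p b) ∧
    ∀ p' q' : M → M, ComplPair p' q' → algLe (p' a) (p' b) →
      ∀ x : M, algLe (p' x) (p x)

/-- Directly finite element. -/
def DirectlyFinite (c : M) : Prop := ∀ x : M, x + c = c → x = 0

/-- Purely infinite element. -/
def PurelyInfinite (c : M) : Prop := c + c = c

/-- `b` is an infimum of `X` for the algebraic preorder. -/
def IsInfOf (b : M) (X : Set M) : Prop :=
  (∀ x ∈ X, algLe b x) ∧ ∀ y : M, (∀ x ∈ X, algLe y x) → algLe y b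

/-- `b` is a supremum of `X` for the algebraic preorder. -/
def IsSupOf (b : M) (X : Set M) : Prop :=
  (∀ x ∈ X, algLe x b) ∧ ∀ y : M, (∀ x ∈ X, algLe x y) → algLe b y

/-- Antisymmetry of the algebraic preorder. -/
def Antisymm (M : Type*) [AddCommMonoid M] : Prop :=
  ∀ a b : M, algLe a b → algLe b a → a = b

/-- Axiom (M5): every element is the sum of a directly finite element and a
purely infinite element. -/
def AxiomM5 (M : Type*) [AddCommMonoid M] : Prop :=
  ∀ a : M, ∃ x y : M, DirectlyFinite x ∧ PurelyInfinite y ∧ a = x + y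

/-- Axiom (M2): every nonempty subset has an infimum. -/
def AxiomM2 (M : Type*) [AddCommMonoid M] : Prop :=
  ∀ X : Set M, X.Nonempty → ∃ b : M, IsInfOf b X

theorem algLe_trans {a b c : M} (h₁ : algLe a b) (h₂ : algLe b c) : algLe a c := by
  obtain ⟨x, rfl⟩ := h₁
  obtain ⟨y, rfl⟩ := h₂
  exact ⟨x + y, (add_assoc _ _ _).symm⟩

theorem algLe_refl (a : M) : algLe a a := ⟨0, add_zero a⟩

theorem Conical.eq_zero_of_algLe (hCon : Conical M) {a : M} (h : algLe a 0) : a = 0 := by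
  obtain ⟨c, hc⟩ := h
  exact (hCon a c hc).1

theorem Orth.symm {a b : M} (h : Orth a b) : Orth b a := fun x hb ha => h x ha hb

theorem Orth.mono_left {a b c : M} (h : Orth b c) (hab : algLe a b) : Orth a c :=
  fun x ha hc => h x (algLe_trans ha hab) hc

theorem Orth.eq_zero_of_algLe {a b : M} (h : Orth a b) (hab : algLe a b) : a = 0 :=
  h a (algLe_refl a) hab

theorem IsAddEndo.algLe_map {p : M → M} (hp : IsAddEndo p) {a b : M} (h : algLe a b) :
    algLe (p a) (p b) := by
  obtain ⟨c, rfl⟩ := h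
  exact ⟨p c, (hp.2 a c).symm⟩

theorem ComplPair.symm {p q : M → M} (h : ComplPair p q) : ComplPair q p :=
  ⟨h.2.1, h.1, fun x => ⟨(add_comm _ _).trans (h.2.2 x).1, (h.2.2 x).2.2, (h.2.2 x).2.1⟩⟩

theorem ComplPair.algLe_left {p q : M → M} (h : ComplPair p q) (x : M) : algLe (p x) x :=
  ⟨q x, (h.2.2 x).1⟩

theorem ComplPair.eq_left {p q : M → M} (h : ComplPair p q) {x : M} (hx : q x = 0) :
    p x = x := by
  simpa [hx] using (h.2.2 x).1

/-- Every principal polar is a direct summand: there are complementary projections onto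
`{x}^⊥` and `{x}^⊥⊥`. -/
theorem exists_complPair_orth (hCon : Conical M) (hGC : GenComp M) (hBV : BoolValued M) (x : M) :
    ∃ p q : M → M, ComplPair p q ∧ (∀ z, Orth (p z) x) ∧
      ∀ z s, Orth s x → Orth (q z) s := by
  obtain ⟨p, q, hpq, hpx, hmax⟩ := hBV x 0
  rw [hpq.1.1] at hpx
  refine ⟨p, q, hpq, fun z w hwz hwx => ?_, fun z s hs w hwz hws => ?_⟩
  · have hp : p w = 0 := hCon.eq_zero_of_algLe (algLe_trans (hpq.1.algLe_map hwx) hpx)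
    have hq : algLe (q w) (q (p z)) := hpq.2.1.algLe_map hwz
    rw [(hpq.2.2 z).2.2] at hq
    rw [← hpq.eq_left (hCon.eq_zero_of_algLe hq), hp]
  · have hwx : Orth w x := hs.mono_left hws
    obtain ⟨p', q', hpq', hp', hq'⟩ := hGC w x
    have hpw : p' w = 0 :=
      hwx _ (hpq'.algLe_left w) (algLe_trans hp' (hpq'.algLe_left x))
    have hqx : q' x = 0 :=
      hwx _ (algLe_trans hq' (hpq'.symm.algLe_left w)) (hpq'.symm.algLe_left x)
    have hle : algLe (q' w) (p w) :=
      hmax q' p' hpq'.symm (by rw [hqx, hpq'.2.1.1]; exact algLe_refl 0) w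
    rw [hpq'.symm.eq_left hpw] at hle
    have hpw0 : algLe (p w) (p (q z)) := hpq.1.algLe_map hwz
    rw [(hpq.2.2 z).2.1] at hpw0
    exact hCon.eq_zero_of_algLe (algLe_trans hle hpw0)

/-- The elements of `X^⊥` below `z` are exactly the lower bounds of a suitable
element of `X^⊥`. -/
theorem exists_mem_perpSet_forall_algLe (hCon : Conical M) (hM2 : AxiomM2 M) (hGC : GenComp M)
    (hBV : BoolValued M) (X : Set M) (z : M) :
    ∃ u ∈ perpSet X, ∀ w ∈ perpSet X, algLe w z → algLe w u := by
  rcases X.eq_empty_or_nonempty with rfl | ⟨x₀, hx₀⟩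
  · exact ⟨z, fun x hx => absurd hx (Set.notMem_empty x), fun _ _ h => h⟩
  choose p q hpq hp hq using exists_complPair_orth hCon hGC hBV
  obtain ⟨u, hlow, hgreat⟩ := hM2 ((fun x => p x z) '' X) ⟨_, x₀, hx₀, rfl⟩
  refine ⟨u, fun x hx => (hp x z).mono_left (hlow _ ⟨x, hx, rfl⟩), fun w hw hwz => ?_⟩
  refine hgreat w ?_
  rintro _ ⟨x, hx, rfl⟩
  have hqw : q x w = 0 :=
    (hq x w w (hw x hx)).eq_zero_of_algLe ((hpq x).symm.algLe_left w)
  have h := (hpq x).1.algLe_map hwz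
  rwa [(hpq x).eq_left hqw] at h

/-- Decompositions with respect to `X^⊥` and `X^⊥⊥` are unique in a refinement monoid. -/
theorem Refinement.eq_and_eq_of_add_eq_add (hRef : Refinement M) {X : Set M} {u v u' v' : M}
    (hu : u ∈ perpSet X) (hv : v ∈ perpSet (perpSet X)) (hu' : u' ∈ perpSet X)
    (hv' : v' ∈ perpSet (perpSet X)) (h : u + v = u' + v') : u' = u ∧ v' = v := by
  obtain ⟨c₀₀, c₀₁, c₁₀, c₁₁, rfl, rfl, rfl, rfl⟩ := hRef u v u' v' h
  have h₁ : c₀₁ = 0 := hv' _ hu _ ⟨c₁₁, rfl⟩ ⟨c₀₀, add_comm _ _⟩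
  have h₂ : c₁₀ = 0 := hv _ hu' _ ⟨c₁₁, rfl⟩ ⟨c₀₀, add_comm _ _⟩
  simp [h₁, h₂]

theorem statement15 (hCon : Conical M) (hRef : Refinement M)
    (hAnti : Antisymm M) (hM2 : AxiomM2 M) (hGC : GenComp M)
    (hBV : BoolValued M) (hM5 : AxiomM5 M) :
    ∀ X : Set M, ∀ z : M,
      ∃ u v : M, u ∈ perpSet X ∧ v ∈ perpSet (perpSet X) ∧ z = u + v ∧
        ∀ u' v' : M, u' ∈ perpSet X → v' ∈ perpSet (perpSet X) →
          z = u' + v' → u' = u ∧ v' = v := by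
  intro X z
  obtain ⟨a, ha, hmax⟩ := exists_mem_perpSet_forall_algLe hCon hM2 hGC hBV X z
  obtain ⟨p, q, hpq, hp, hq⟩ := exists_complPair_orth hCon hGC hBV a
  have hu : q z ∈ perpSet X := fun x hx => hq z x (ha x hx).symm
  have hv : p z ∈ perpSet (perpSet X) := fun s hs w hwz hws =>
    hp z w hwz (hmax w (fun x hx => (hs x hx).mono_left hws)
      (algLe_trans hwz (hpq.algLe_left z)))
  have hz : z = q z + p z := (hpq.symm.2.2 z).1.symm
  exact ⟨q z, p z, hu, hv, hz, fun u' v' hu' hv' h =>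
    hRef.eq_and_eq_of_add_eq_add hu hv hu' hv' (hz.symm.trans h)⟩

end PaperCDS
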